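/- arXiv:0710.1844 — 2 statements merged into one kernel-verified Lean document; each statement's English description precedes it below -/
import Mathlib

section
/- Let n ≥ 1, let Ω ⊆ EuclideanSpace ℝ (Fin n) be a bounded open set and let H : Ω → ℝ. Suppose u and v are continuous on the closure of Ω, twice continuously differentiable on Ω, and both satisfy the prescribed mean curvature equation Σᵢ ∂ᵢ(∂ᵢw/√(1 + ‖∇w‖²)) = n·H(x) at every point x ∈ Ω. If u = v on the boundary ∂Ω = closure(Ω) \ Ω, then u = v on all of closure(Ω). -/
/-- The quasilinear mean curvature operator for Euclidean graphs:
`Q[u](x) = Σᵢ ∂ᵢ(∂ᵢu / √(1 + ‖∇u‖²))(x)`. -/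
noncomputable def meanCurvOp (n : ℕ) (u : EuclideanSpace ℝ (Fin n) → ℝ)
    (x : EuclideanSpace ℝ (Fin n)) : ℝ :=
  ∑ i : Fin n,
    fderiv ℝ
      (fun y => fderiv ℝ u y (EuclideanSpace.single i (1 : ℝ)) /
        Real.sqrt (1 + ‖gradient u y‖ ^ 2))
      x (EuclideanSpace.single i (1 : ℝ))

open MeasureTheory Filter Topology Set

/-- The map `p ↦ p / √(1 + ‖p‖²)`, which sends the gradient of a function to (minus) the horizontal
part of the upward unit normal of its graph, is monotone. -/
theorem inner_sub_normalized_nonneg {F : Type*} [NormedAddCommGroup F] [InnerProductSpace ℝ F]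
    (p q : F) :
    0 ≤ inner ℝ (p - q) ((√(1 + ‖p‖ ^ 2))⁻¹ • p - (√(1 + ‖q‖ ^ 2))⁻¹ • q) ∧
      (inner ℝ (p - q) ((√(1 + ‖p‖ ^ 2))⁻¹ • p - (√(1 + ‖q‖ ^ 2))⁻¹ • q) = 0 → p = q) := by
  set a := √(1 + ‖p‖ ^ 2) with ha
  set b := √(1 + ‖q‖ ^ 2) with hb
  have ha0 : 0 < a := Real.sqrt_pos.2 (by positivity)
  have hb0 : 0 < b := Real.sqrt_pos.2 (by positivity)
  have ha2 : inner ℝ p p = a ^ 2 - 1 := by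
    rw [real_inner_self_eq_norm_sq, ha, Real.sq_sqrt (by positivity)]; ring
  have hb2 : inner ℝ q q = b ^ 2 - 1 := by
    rw [real_inner_self_eq_norm_sq, hb, Real.sq_sqrt (by positivity)]; ring
  have key : inner ℝ (p - q) (a⁻¹ • p - b⁻¹ • q) =
      (a + b) / 2 * (‖a⁻¹ • p - b⁻¹ • q‖ ^ 2 + (a⁻¹ - b⁻¹) ^ 2) := by
    rw [← real_inner_self_eq_norm_sq]
    simp only [inner_sub_left, inner_sub_right, real_inner_smul_left, real_inner_smul_right,
      real_inner_comm p q, ha2, hb2]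
    field_simp
    ring
  rw [key]
  refine ⟨by positivity, fun h ↦ ?_⟩
  have h0 : ‖a⁻¹ • p - b⁻¹ • q‖ ^ 2 + (a⁻¹ - b⁻¹) ^ 2 = 0 :=
    (mul_eq_zero.1 h).resolve_left (by positivity)
  have h1 : a⁻¹ - b⁻¹ = 0 := by nlinarith [sq_nonneg ‖a⁻¹ • p - b⁻¹ • q‖, sq_nonneg (a⁻¹ - b⁻¹)]
  have h2 : a⁻¹ • p - b⁻¹ • q = 0 := by
    rw [h1] at h0
    simpa using h0
  rw [← sub_eq_zero.1 h1, ← smul_sub] at h2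
  exact sub_eq_zero.1 ((smul_eq_zero.1 h2).resolve_left (by positivity))

/-- A function which is `C^k` on an open set and vanishes outside a closed subset of it is `C^k`. -/
theorem ContDiffOn.contDiff_of_eq_zero_off_isClosed {E F : Type*} [NormedAddCommGroup E]
    [NormedSpace ℝ E] [NormedAddCommGroup F] [NormedSpace ℝ F] {k : WithTop ℕ∞} {f : E → F}
    {Ω K : Set E} (hf : ContDiffOn ℝ k f Ω) (hΩ : IsOpen Ω) (hK : IsClosed K) (hKΩ : K ⊆ Ω)
    (h0 : ∀ x ∉ K, f x = 0) : ContDiff ℝ k f := by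
  refine contDiff_iff_contDiffAt.2 fun x ↦ ?_
  by_cases hx : x ∈ K
  · exact hf.contDiffAt (hΩ.mem_nhds (hKΩ hx))
  · refine (contDiffAt_const (c := (0 : F))).congr_of_eventuallyEq ?_
    filter_upwards [hK.isOpen_compl.mem_nhds hx] with y hy using h0 y hy

/-- A compactly supported `C¹` vector field with nonnegative divergence is divergence free. -/
theorem sum_fderiv_apply_eq_zero_of_nonneg {E ι : Type*} [NormedAddCommGroup E] [NormedSpace ℝ E]
    [FiniteDimensional ℝ E] [Fintype ι] {G : ι → E → ℝ} {e : ι → E}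
    (hG : ∀ i, ContDiff ℝ 1 (G i)) (hc : ∀ i, HasCompactSupport (G i))
    (hnonneg : ∀ x, 0 ≤ ∑ i, fderiv ℝ (G i) x (e i)) (x : E) :
    ∑ i, fderiv ℝ (G i) x (e i) = 0 := by
  borelize E
  let μ : Measure E := Measure.addHaar
  have hcont : ∀ i, Continuous fun x ↦ fderiv ℝ (G i) x (e i) := fun i ↦
    ((hG i).continuous_fderiv one_ne_zero).clm_apply continuous_const
  have hint : ∀ i, Integrable (fun x ↦ fderiv ℝ (G i) x (e i)) μ := fun i ↦
    (hcont i).integrable_of_hasCompactSupport ((hc i).fderiv_apply ℝ (e i))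
  have hzero : ∀ i, ∫ x, fderiv ℝ (G i) x (e i) ∂μ = 0 := fun i ↦ by
    have := integral_mul_fderiv_eq_neg_fderiv_mul_of_integrable (μ := μ) (f := fun _ ↦ (1 : ℝ))
      (g := G i) (v := e i) (by simp) (by simpa using hint i)
      (by simpa using (hG i).continuous.integrable_of_hasCompactSupport (hc i))
      (by fun_prop) (fun x _ ↦ (hG i).differentiable one_ne_zero x)
    simpa using this
  have hsum : ∫ x, ∑ i, fderiv ℝ (G i) x (e i) ∂μ = 0 := by
    rw [integral_finsetSum _ fun i _ ↦ hint i]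
    simp [hzero]
  rw [integral_eq_zero_iff_of_nonneg hnonneg (integrable_finsetSum _ fun i _ ↦ hint i)] at hsum
  exact congrFun ((continuous_finsetSum _ fun i _ ↦ hcont i).ae_eq_iff_eq μ
    continuous_const |>.1 hsum) x

theorem gradient_apply_eq_fderiv_single {n : ℕ} (u : EuclideanSpace ℝ (Fin n) → ℝ)
    (x : EuclideanSpace ℝ (Fin n)) (i : Fin n) :
    gradient u x i = fderiv ℝ u x (EuclideanSpace.single i 1) := by
  rw [← toDual_gradient, InnerProductSpace.toDual_apply_apply,
    EuclideanSpace.inner_single_right]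
  simp

theorem ContDiffOn.fderiv_div_sqrt_one_add_gradient {n : ℕ} {u : EuclideanSpace ℝ (Fin n) → ℝ}
    {Ω : Set (EuclideanSpace ℝ (Fin n))} (hu : ContDiffOn ℝ 2 u Ω) (hΩ : IsOpen Ω)
    (e : EuclideanSpace ℝ (Fin n)) :
    ContDiffOn ℝ 1 (fun y ↦ fderiv ℝ u y e / √(1 + ‖gradient u y‖ ^ 2)) Ω := by
  have h : ContDiffOn ℝ 1 (fderiv ℝ u) Ω := hu.fderiv_of_isOpen hΩ (by norm_num)
  have hg : ContDiffOn ℝ 1 (gradient u) Ω :=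
    (InnerProductSpace.toDual ℝ (EuclideanSpace ℝ (Fin n))).symm.contDiff.comp_contDiffOn h
  refine (h.clm_apply contDiffOn_const).div ((contDiffOn_const.add (hg.norm_sq ℝ)).sqrt
    fun x _ ↦ by positivity) fun x _ ↦ by positivity

/-- Comparison principle for graphs of equal mean curvature. -/
theorem le_of_meanCurvOp_eq {n : ℕ} (hn : 1 ≤ n) {Ω : Set (EuclideanSpace ℝ (Fin n))}
    (hΩopen : IsOpen Ω) (hΩbd : Bornology.IsBounded Ω) {u v : EuclideanSpace ℝ (Fin n) → ℝ}
    (hu_cont : ContinuousOn u (closure Ω)) (hv_cont : ContinuousOn v (closure Ω))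
    (hu_C2 : ContDiffOn ℝ 2 u Ω) (hv_C2 : ContDiffOn ℝ 2 v Ω)
    (heq : ∀ x ∈ Ω, meanCurvOp n u x = meanCurvOp n v x)
    (hbd : ∀ x ∈ closure Ω \ Ω, u x ≤ v x) :
    ∀ x ∈ closure Ω, u x ≤ v x := by
  intro x₀ hx₀
  by_contra! hlt
  set ε := (u x₀ - v x₀) / 2 with hε
  have hε0 : 0 < ε := by linarith
  let K : Set (EuclideanSpace ℝ (Fin n)) := closure Ω ∩ (fun x ↦ u x - v x) ⁻¹' Ici ε
  have hKclosed : IsClosed K :=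
    (hu_cont.sub hv_cont).preimage_isClosed_of_isClosed isClosed_closure isClosed_Ici
  have hKΩ : K ⊆ Ω := fun x hx ↦ by
    by_contra hxΩ
    have h1 := hbd x ⟨hx.1, hxΩ⟩
    have h2 : ε ≤ u x - v x := hx.2
    linarith
  have hKcompact : IsCompact K :=
    Metric.isCompact_of_isClosed_isBounded hKclosed (hΩbd.subset hKΩ)
  let φ := Ω.indicator fun x ↦ expNegInvGlue (u x - v x - ε)
  have hφΩ : EqOn φ (fun x ↦ expNegInvGlue (u x - v x - ε)) Ω := fun x hx ↦ indicator_of_mem hx _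
  have hφK : ∀ x ∉ K, φ x = 0 := fun x hx ↦ by
    by_cases hxΩ : x ∈ Ω
    · rw [hφΩ hxΩ]
      refine expNegInvGlue.zero_of_nonpos ?_
      by_contra! h
      exact hx ⟨subset_closure hxΩ, show ε ≤ u x - v x by linarith⟩
    · exact indicator_of_notMem hxΩ _
  have hη : ContDiff ℝ 1 expNegInvGlue := expNegInvGlue.contDiff (n := 1)
  have hφ_on : ContDiffOn ℝ 1 φ Ω := by
    refine ContDiffOn.congr ?_ hφΩ
    exact hη.comp_contDiffOn
      (((hu_C2.sub hv_C2).of_le (by norm_num)).sub contDiffOn_const)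
  have hφ : ContDiff ℝ 1 φ := hφ_on.contDiff_of_eq_zero_off_isClosed hΩopen hKclosed hKΩ hφK
  let e : Fin n → EuclideanSpace ℝ (Fin n) := fun i ↦ EuclideanSpace.single i 1
  let U : Fin n → EuclideanSpace ℝ (Fin n) → ℝ := fun i y ↦
    fderiv ℝ u y (e i) / √(1 + ‖gradient u y‖ ^ 2)
  let V : Fin n → EuclideanSpace ℝ (Fin n) → ℝ := fun i y ↦
    fderiv ℝ v y (e i) / √(1 + ‖gradient v y‖ ^ 2)
  have hU : ∀ i, ContDiffOn ℝ 1 (U i) Ω := fun i ↦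
    hu_C2.fderiv_div_sqrt_one_add_gradient hΩopen (e i)
  have hV : ∀ i, ContDiffOn ℝ 1 (V i) Ω := fun i ↦
    hv_C2.fderiv_div_sqrt_one_add_gradient hΩopen (e i)
  let G : Fin n → EuclideanSpace ℝ (Fin n) → ℝ := fun i y ↦ φ y * (U i y - V i y)
  have hGK : ∀ i, ∀ x ∉ K, G i x = 0 := fun i x hx ↦ by simp [G, hφK x hx]
  have hG : ∀ i, ContDiff ℝ 1 (G i) := fun i ↦
    (hφ_on.mul ((hU i).sub (hV i))).contDiff_of_eq_zero_off_isClosed hΩopen hKclosed hKΩ (hGK i)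
  have hGc : ∀ i, HasCompactSupport (G i) := fun i ↦ .intro hKcompact (hGK i)
  let η' : EuclideanSpace ℝ (Fin n) → ℝ := fun x ↦ deriv expNegInvGlue (u x - v x - ε)
  have hη' : ∀ x, 0 ≤ η' x := fun x ↦ expNegInvGlue.monotone.deriv_nonneg
  have hfφ : ∀ x ∈ Ω, fderiv ℝ φ x = η' x • (fderiv ℝ u x - fderiv ℝ v x) := fun x hx ↦ by
    have hnhds := hΩopen.mem_nhds hx
    have hu := ((hu_C2.contDiffAt hnhds).differentiableAt two_ne_zero).hasFDerivAt
    have hv := ((hv_C2.contDiffAt hnhds).differentiableAt two_ne_zero).hasFDerivAt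
    have h := (hη.differentiable one_ne_zero (u x - v x - ε)).hasDerivAt.comp_hasFDerivAt x
      ((hu.sub hv).sub_const ε)
    exact (h.congr_of_eventuallyEq (hφΩ.eventuallyEq_of_mem hnhds)).fderiv
  have hdiv : ∀ x ∈ Ω, ∑ i, fderiv ℝ (G i) x (e i) =
      η' x * inner ℝ (gradient u x - gradient v x)
        ((√(1 + ‖gradient u x‖ ^ 2))⁻¹ • gradient u x -
          (√(1 + ‖gradient v x‖ ^ 2))⁻¹ • gradient v x) := fun x hx ↦ by
    have hnhds := hΩopen.mem_nhds hx
    have hU' i := ((hU i).contDiffAt hnhds).differentiableAt one_ne_zero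
    have hV' i := ((hV i).contDiffAt hnhds).differentiableAt one_ne_zero
    have hφ' := hφ.differentiable one_ne_zero x
    have h i : fderiv ℝ (G i) x (e i) =
        φ x * (fderiv ℝ (U i) x (e i) - fderiv ℝ (V i) x (e i)) +
          (U i x - V i x) * fderiv ℝ φ x (e i) := by
      simp only [G]
      rw [fderiv_fun_mul hφ' ((hU' i).fun_sub (hV' i)), fderiv_fun_sub (hU' i) (hV' i)]
      simp
    have hmc : ∑ i, fderiv ℝ (U i) x (e i) = ∑ i, fderiv ℝ (V i) x (e i) := heq x hx
    simp only [h, Finset.sum_add_distrib, ← Finset.mul_sum, Finset.sum_sub_distrib, hmc, sub_self,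
      mul_zero, zero_add, hfφ x hx, PiLp.inner_apply]
    rw [Finset.mul_sum]
    refine Finset.sum_congr rfl fun i _ ↦ ?_
    simp [U, V, e, gradient_apply_eq_fderiv_single, div_eq_inv_mul]
    ring
  have hfφ0 : ∀ x, fderiv ℝ φ x = 0 := fun x ↦ by
    by_cases hx : x ∈ Ω
    · have h0 := sum_fderiv_apply_eq_zero_of_nonneg (e := e) hG hGc (fun y ↦ ?_) x
      · rw [hdiv x hx] at h0
        rw [hfφ x hx]
        rcases mul_eq_zero.1 h0 with h | h
        · rw [h, zero_smul]
        · rw [← toDual_gradient, ← toDual_gradient,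
            (inner_sub_normalized_nonneg _ _).2 h, sub_self, smul_zero]
      · by_cases hy : y ∈ Ω
        · rw [hdiv y hy]
          exact mul_nonneg (hη' y) (inner_sub_normalized_nonneg _ _).1
        · refine (Finset.sum_eq_zero fun i _ ↦ ?_).ge
          have : G i =ᶠ[𝓝 y] fun _ ↦ 0 := by
            filter_upwards [hKclosed.isOpen_compl.mem_nhds fun h ↦ hy (hKΩ h)] with z hz
              using hGK i z hz
          simp [this.fderiv_eq]
    · have : φ =ᶠ[𝓝 x] fun _ ↦ 0 := by
        filter_upwards [hKclosed.isOpen_compl.mem_nhds fun h ↦ hx (hKΩ h)] with z hz using hφK z hz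
      simp [this.fderiv_eq]
  have : Nonempty (Fin n) := ⟨⟨0, hn⟩⟩
  obtain ⟨y, hy⟩ : ∃ y, y ∉ K := by
    by_contra! h
    exact NormedSpace.unbounded_univ ℝ (EuclideanSpace ℝ (Fin n))
      (hKcompact.isBounded.subset fun x _ ↦ h x)
  have hφx₀ : φ x₀ = 0 := by
    rw [is_const_of_fderiv_eq_zero (hφ.differentiable one_ne_zero) hfφ0 x₀ y, hφK y hy]
  have hx₀K : x₀ ∈ K := ⟨hx₀, show ε ≤ u x₀ - v x₀ by linarith⟩
  rw [hφΩ (hKΩ hx₀K)] at hφx₀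
  exact (expNegInvGlue.pos_of_pos (show 0 < u x₀ - v x₀ - ε by linarith)).ne hφx₀.symm

/-- Uniqueness for the Dirichlet problem for graphs of prescribed mean curvature
in the Euclidean setting: two solutions of `Q[w] = nH` on a bounded open set `Ω`
that agree on the boundary `∂Ω = closure Ω \ Ω` agree on all of `closure Ω`. -/
theorem prescribed_mean_curvature_uniqueness
    (n : ℕ) (hn : 1 ≤ n) (Ω : Set (EuclideanSpace ℝ (Fin n)))
    (hΩopen : IsOpen Ω) (hΩbd : Bornology.IsBounded Ω)
    (H : Ω → ℝ)
    (u v : EuclideanSpace ℝ (Fin n) → ℝ)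
    (hu_cont : ContinuousOn u (closure Ω)) (hv_cont : ContinuousOn v (closure Ω))
    (hu_C2 : ContDiffOn ℝ 2 u Ω) (hv_C2 : ContDiffOn ℝ 2 v Ω)
    (hu_eq : ∀ x (hx : x ∈ Ω), meanCurvOp n u x = n * H ⟨x, hx⟩)
    (hv_eq : ∀ x (hx : x ∈ Ω), meanCurvOp n v x = n * H ⟨x, hx⟩)
    (hbd : ∀ x ∈ closure Ω \ Ω, u x = v x) :
    ∀ x ∈ closure Ω, u x = v x := by
  have heq : ∀ x ∈ Ω, meanCurvOp n u x = meanCurvOp n v x := fun x hx ↦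
    (hu_eq x hx).trans (hv_eq x hx).symm
  intro x hx
  exact le_antisymm
    (le_of_meanCurvOp_eq hn hΩopen hΩbd hu_cont hv_cont hu_C2 hv_C2 heq
      (fun y hy ↦ (hbd y hy).le) x hx)
    (le_of_meanCurvOp_eq hn hΩopen hΩbd hv_cont hu_cont hv_C2 hu_C2
      (fun y hy ↦ (heq y hy).symm) (fun y hy ↦ (hbd y hy).ge) x hx)
end

section
/- Let n ≥ 2, R > 0, and let Ω be the open ball of radius R centered at the origin in EuclideanSpace ℝ (Fin n). For all real numbers M > 0 and K > 0 there exists a constant C > 0, depending only on n, R, M and K, with the following property: for every continuous H : closure(Ω) → ℝ with sup_{closure(Ω)} |H| ≤ (n−1)/(nR), every φ : EuclideanSpace ℝ (Fin n) → ℝ twice continuously differentiable with |φ| + ‖∇φ‖ + ‖D²φ‖ ≤ K on closure(Ω), and every u that is continuously differentiable on closure(Ω), twice continuously differentiable on Ω, satisfies Σᵢ ∂ᵢ(∂ᵢu/√(1 + ‖∇u‖²)) = n·H(x) on Ω, satisfies u = φ on ∂Ω, and satisfies sup_{closure(Ω)} |u| ≤ M, one has sup_{∂Ω} ‖∇u‖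 ≤ C. -/
open Filter Topology

theorem EuclideanSpace.eq_sum_smul_single {n : ℕ} (p : EuclideanSpace ℝ (Fin n)) :
    p = ∑ i, p i • EuclideanSpace.single i (1 : ℝ) := by
  ext j
  simp [Finset.sum_apply, Pi.single_apply]

/-- The symbol `(1 + ‖p‖²) I - p ⊗ p` of the minimal surface operator contracted with a
bilinear form is nonpositive as soon as the bilinear form is nonpositive on the diagonal. -/
theorem mul_sum_sub_nonpos_of_diag_nonpos {n : ℕ}
    (B : EuclideanSpace ℝ (Fin n) →ₗ[ℝ] EuclideanSpace ℝ (Fin n) →ₗ[ℝ] ℝ)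
    (hB : ∀ e, B e e ≤ 0) (p : EuclideanSpace ℝ (Fin n)) :
    (1 + ‖p‖ ^ 2) * ∑ i, B (EuclideanSpace.single i 1) (EuclideanSpace.single i 1) - B p p
      ≤ 0 := by
  set e : Fin n → EuclideanSpace ℝ (Fin n) := fun i => EuclideanSpace.single i (1 : ℝ) with he
  have hBp : B p p = ∑ i, ∑ j, p i * p j * B (e i) (e j) := by
    conv_lhs => rw [EuclideanSpace.eq_sum_smul_single p]
    simp only [map_sum, LinearMap.sum_apply, map_smul, LinearMap.smul_apply, smul_eq_mul,
      Finset.mul_sum]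
    rw [Finset.sum_comm]
    refine Finset.sum_congr rfl fun i _ => Finset.sum_congr rfl fun j _ => ?_
    simp only [he]
    ring
  have hpn : ‖p‖ ^ 2 = ∑ i, p i ^ 2 := EuclideanSpace.real_norm_sq_eq p
  have hpair : ∑ i, ∑ j, (p i ^ 2 * B (e j) (e j) + p j ^ 2 * B (e i) (e i)
      - p i * p j * B (e i) (e j) - p j * p i * B (e j) (e i)) ≤ 0 := by
    refine Finset.sum_nonpos fun i _ => Finset.sum_nonpos fun j _ => ?_
    have h := hB (p i • e j - p j • e i)
    simp only [map_sub, map_smul, LinearMap.sub_apply, LinearMap.smul_apply, smul_eq_mul] at h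
    linarith
  simp only [Finset.sum_sub_distrib, Finset.sum_add_distrib] at hpair
  rw [Finset.sum_comm (f := fun i j => p j ^ 2 * B (e i) (e i)),
    Finset.sum_comm (f := fun i j => p j * p i * B (e j) (e i)), ← hBp,
    ← Finset.sum_mul_sum, ← hpn] at hpair
  have htr : ∑ i, B (e i) (e i) ≤ 0 := Finset.sum_nonpos fun i _ => hB _
  change (1 + ‖p‖ ^ 2) * ∑ i, B (e i) (e i) - B p p ≤ 0
  linarith

theorem hasDerivAt_comp_add_smul {E F : Type*} [NormedAddCommGroup E] [NormedSpace ℝ E]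
    [NormedAddCommGroup F] [NormedSpace ℝ F] {f : E → F} {x e : E} {t : ℝ}
    (hf : DifferentiableAt ℝ f (x + t • e)) :
    HasDerivAt (fun s : ℝ => f (x + s • e)) (fderiv ℝ f (x + t • e) e) t := by
  have h1 : HasDerivAt (fun s : ℝ => x + s • e) e t := by
    simpa using ((hasDerivAt_id t).smul_const e).const_add x
  exact hf.hasFDerivAt.comp_hasDerivAt t h1

/-- Expanded (nondivergence) form of the mean curvature operator. -/
theorem meanCurvOp_eq {n : ℕ} {u : EuclideanSpace ℝ (Fin n) → ℝ} {x : EuclideanSpace ℝ (Fin n)}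
    (hu : ContDiffAt ℝ 2 u x) :
    √(1 + ‖gradient u x‖ ^ 2) ^ 3 * meanCurvOp n u x =
      (1 + ‖gradient u x‖ ^ 2) * ∑ i, fderiv ℝ (fderiv ℝ u) x
          (EuclideanSpace.single i 1) (EuclideanSpace.single i 1)
        - fderiv ℝ (fderiv ℝ u) x (gradient u x) (gradient u x) := by
  have hd : DifferentiableAt ℝ (fderiv ℝ u) x :=
    (hu.fderiv_right (m := 1) (by norm_num)).differentiableAt (by norm_num)
  have hgrad : gradient u = fun y => (InnerProductSpace.toDual ℝ _).symm (fderiv ℝ u y) := rfl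
  have hgd : DifferentiableAt ℝ (gradient u) x := by
    rw [hgrad]
    exact (InnerProductSpace.toDual ℝ
      (EuclideanSpace ℝ (Fin n))).symm.toContinuousLinearEquiv.differentiableAt.comp x hd
  set D := fderiv ℝ (fderiv ℝ u) x with hD
  set p := gradient u x with hp
  have hpos : 0 < 1 + ‖p‖ ^ 2 := by positivity
  set W := √(1 + ‖p‖ ^ 2) with hW
  have hWpos : 0 < W := Real.sqrt_pos.2 hpos
  have hW2 : W ^ 2 = 1 + ‖p‖ ^ 2 := Real.sq_sqrt hpos.le
  have key : ∀ e : EuclideanSpace ℝ (Fin n),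
      fderiv ℝ (fun y => fderiv ℝ u y e / √(1 + ‖gradient u y‖ ^ 2)) x e
        = (D e e * W - fderiv ℝ u x e * (D e p / W)) / W ^ 2 := by
    intro e
    have hsq : DifferentiableAt ℝ (fun y => √(1 + ‖gradient u y‖ ^ 2)) x :=
      ((hgd.norm_sq ℝ).const_add 1).sqrt hpos.ne'
    have hnum : DifferentiableAt ℝ (fun y => fderiv ℝ u y e) x :=
      hd.clm_apply (differentiableAt_const e)
    have hF : DifferentiableAt ℝ
        (fun y => fderiv ℝ u y e / √(1 + ‖gradient u y‖ ^ 2)) x :=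
      by simpa only [div_eq_mul_inv] using hnum.fun_mul (hsq.fun_inv hWpos.ne')
    rw [← hF.lineDeriv_eq_fderiv]
    have h1 : HasDerivAt (fun t : ℝ => fderiv ℝ u (x + t • e)) (D e) 0 := by
      simpa using hasDerivAt_comp_add_smul (f := fderiv ℝ u) (x := x) (e := e) (t := 0)
        (by simpa using hd)
    have h2 : HasDerivAt (fun t : ℝ => fderiv ℝ u (x + t • e) e) (D e e) 0 := by
      simpa using h1.clm_apply (hasDerivAt_const (0 : ℝ) e)
    have h3 : HasDerivAt (fun t : ℝ => gradient u (x + t • e))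
        ((InnerProductSpace.toDual ℝ _).symm (D e)) 0 := by
      rw [hgrad]
      exact (InnerProductSpace.toDual ℝ
        (EuclideanSpace ℝ (Fin n))).symm.toContinuousLinearEquiv.hasFDerivAt.comp_hasDerivAt 0 h1
    have h4 := ((h3.norm_sq).const_add 1).sqrt (by simpa using hpos.ne')
    have h5 := h2.fun_div h4 (by simpa using hWpos.ne')
    have h6 := h5.deriv
    rw [lineDeriv]
    rw [h6]
    simp only [zero_smul, add_zero, ← hp, ← hW]
    rw [real_inner_comm, InnerProductSpace.toDual_symm_apply]
    field_simp
  have hsum : ∑ i, fderiv ℝ u x (EuclideanSpace.single i 1) * D (EuclideanSpace.single i 1) p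
      = D p p := by
    have : ∀ i, fderiv ℝ u x (EuclideanSpace.single i 1) = p i := by
      intro i
      rw [← inner_gradient_left, ← hp]
      simp [EuclideanSpace.inner_single_right]
    simp only [this]
    conv_rhs =>
      arg 1
      rw [EuclideanSpace.eq_sum_smul_single p]
    simp
  unfold meanCurvOp
  simp only [key]
  rw [← hsum, ← hW2, Finset.mul_sum, Finset.mul_sum, ← Finset.sum_sub_distrib]
  refine Finset.sum_congr rfl fun i _ => ?_
  field_simp

theorem meanCurvOp_neg {n : ℕ} (u : EuclideanSpace ℝ (Fin n) → ℝ) (x : EuclideanSpace ℝ (Fin n)) :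
    meanCurvOp n (fun y => -u y) x = -meanCurvOp n u x := by
  have hg : ∀ y, ‖gradient (fun y => -u y) y‖ = ‖gradient u y‖ := by
    intro y
    simp [gradient, fderiv_fun_neg]
  simp only [meanCurvOp, hg, fderiv_fun_neg, neg_apply, neg_div,
    Finset.sum_neg_distrib]

/-- Second derivative test, necessary condition at a local maximum. -/
theorem IsLocalMax.second_deriv_nonpos {g g' : ℝ → ℝ} {c a : ℝ} (hmax : IsLocalMax g a)
    (hg : ∀ᶠ t in 𝓝 a, HasDerivAt g (g' t) t) (hg' : HasDerivAt g' c a) : c ≤ 0 := by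
  by_contra! hc
  have hderiv : deriv g =ᶠ[𝓝 a] g' := hg.mono fun t ht => ht.deriv
  have hmin : IsLocalMin g a := by
    refine isLocalMin_of_deriv_deriv_pos ?_ hmax.deriv_eq_zero hg.self_of_nhds.continuousAt
    rw [hderiv.deriv_eq, hg'.deriv]
    exact hc
  have hconst : g =ᶠ[𝓝 a] fun _ => g a := by
    filter_upwards [hmax, hmin] with t h1 h2 using le_antisymm h1 h2
  have h0 : deriv g =ᶠ[𝓝 a] fun _ => 0 := by
    simpa using hconst.deriv
  have : c = 0 := by
    rw [← hg'.deriv, ← hderiv.deriv_eq, h0.deriv_eq]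
    simp
  exact hc.ne' this

/-- The logarithmic barrier, a function of the defining function `(R² - ‖y‖²) / (2R)` of the ball
of radius `R`, restricted to lines. -/
theorem hasDerivAt_log_barrier {E : Type*} [NormedAddCommGroup E] [InnerProductSpace ℝ E]
    {R μ k : ℝ} (hR : R ≠ 0) {x e : E} {t : ℝ}
    (ht : 0 < 1 + k * ((R ^ 2 - ‖x + t • e‖ ^ 2) / (2 * R))) :
    HasDerivAt (fun t : ℝ => μ * Real.log (1 + k * ((R ^ 2 - ‖x + t • e‖ ^ 2) / (2 * R))))
      (-(μ * k * ((inner ℝ x e + t * ‖e‖ ^ 2) / R)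
        / (1 + k * ((R ^ 2 - ‖x + t • e‖ ^ 2) / (2 * R))))) t := by
  have hn : ∀ t : ℝ, ‖x + t • e‖ ^ 2 = ‖x‖ ^ 2 + 2 * (t * inner ℝ x e) + t ^ 2 * ‖e‖ ^ 2 := by
    intro t
    rw [norm_add_sq_real, inner_smul_right, norm_smul, mul_pow, Real.norm_eq_abs, sq_abs]
  simp only [hn] at ht ⊢
  have h1 : HasDerivAt (fun t : ℝ => ‖x‖ ^ 2 + 2 * (t * inner ℝ x e) + t ^ 2 * ‖e‖ ^ 2)
      (2 * (1 * inner ℝ x e) + (2 * t) * ‖e‖ ^ 2) t := by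
    refine ((((hasDerivAt_id t).mul_const _).const_mul 2).const_add _).fun_add ?_
    simpa using ((hasDerivAt_pow 2 t).mul_const (‖e‖ ^ 2))
  have h2 := ((((((h1.const_sub (R ^ 2)).div_const (2 * R)).const_mul k).const_add 1).log
    ht.ne').const_mul μ)
  refine h2.congr_deriv ?_
  field_simp

theorem hasDerivAt_deriv_log_barrier {E : Type*} [NormedAddCommGroup E] [InnerProductSpace ℝ E]
    {R μ k a : ℝ} (hR : R ≠ 0) (hμ : μ ≠ 0) {x e : E}
    (hx : 0 < 1 + k * ((R ^ 2 - ‖x‖ ^ 2) / (2 * R)))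
    (ha : a = μ * k / (1 + k * ((R ^ 2 - ‖x‖ ^ 2) / (2 * R)))) :
    HasDerivAt (fun t : ℝ => -(μ * k * ((inner ℝ x e + t * ‖e‖ ^ 2) / R)
        / (1 + k * ((R ^ 2 - ‖x + t • e‖ ^ 2) / (2 * R)))))
      (-(a * (‖e‖ ^ 2 / R) + a ^ 2 / μ * (inner ℝ x e ^ 2 / R ^ 2))) 0 := by
  have hn : ∀ t : ℝ, ‖x + t • e‖ ^ 2 = ‖x‖ ^ 2 + 2 * (t * inner ℝ x e) + t ^ 2 * ‖e‖ ^ 2 := by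
    intro t
    rw [norm_add_sq_real, inner_smul_right, norm_smul, mul_pow, Real.norm_eq_abs, sq_abs]
  simp only [hn]
  have h1 : HasDerivAt (fun t : ℝ => ‖x‖ ^ 2 + 2 * (t * inner ℝ x e) + t ^ 2 * ‖e‖ ^ 2)
      (2 * (1 * inner ℝ x e) + (2 * 0) * ‖e‖ ^ 2) 0 := by
    refine ((((hasDerivAt_id (0 : ℝ)).mul_const _).const_mul 2).const_add _).fun_add ?_
    simpa using ((hasDerivAt_pow 2 (0 : ℝ)).mul_const (‖e‖ ^ 2))
  have h2 := (((h1.const_sub (R ^ 2)).div_const (2 * R)).const_mul k).const_add 1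
  have h3 : HasDerivAt (fun t : ℝ => μ * k * ((inner ℝ x e + t * ‖e‖ ^ 2) / R))
      (μ * k * ((1 * ‖e‖ ^ 2) / R)) 0 :=
    (((((hasDerivAt_id (0 : ℝ)).mul_const _).const_add _).div_const R).const_mul (μ * k))
  have h4 := (h3.fun_div h2 (by simpa using hx.ne')).fun_neg
  refine h4.congr_deriv ?_
  set q := 1 + k * ((R ^ 2 - ‖x‖ ^ 2) / (2 * R)) with hq
  have hq' : 1 + k * ((R ^ 2 - (‖x‖ ^ 2 + 2 * ((0 : ℝ) * inner ℝ x e) + (0 : ℝ) ^ 2 * ‖e‖ ^ 2))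
      / (2 * R)) = q := by
    rw [hq]; ring
  rw [hq', ha]
  field_simp
  ring

/-- First and second order conditions at a local maximum of `v - barrier`. -/
theorem IsLocalMax.log_barrier_conditions {E : Type*} [NormedAddCommGroup E]
    [InnerProductSpace ℝ E] {R μ k a : ℝ} (hR : R ≠ 0) (hμ : μ ≠ 0) {x : E} {v : E → ℝ}
    (hv : ContDiffAt ℝ 2 v x)
    (hx : 0 < 1 + k * ((R ^ 2 - ‖x‖ ^ 2) / (2 * R)))
    (ha : a = μ * k / (1 + k * ((R ^ 2 - ‖x‖ ^ 2) / (2 * R))))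
    (hmax : IsLocalMax
      (fun y => v y - μ * Real.log (1 + k * ((R ^ 2 - ‖y‖ ^ 2) / (2 * R)))) x) (e : E) :
    fderiv ℝ v x e = -(a * (inner ℝ x e / R)) ∧
      fderiv ℝ (fderiv ℝ v) x e e ≤
        -(a * (‖e‖ ^ 2 / R) + a ^ 2 / μ * (inner ℝ x e ^ 2 / R ^ 2)) := by
  have hline : Continuous fun t : ℝ => x + t • e := by fun_prop
  have hline0 : Tendsto (fun t : ℝ => x + t • e) (𝓝 0) (𝓝 x) := by
    simpa using hline.tendsto 0
  have hmax' : IsLocalMax ((fun y => v y -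
      μ * Real.log (1 + k * ((R ^ 2 - ‖y‖ ^ 2) / (2 * R)))) ∘ fun t : ℝ => x + t • e) 0 := by
    have := hline0.eventually hmax
    simpa [IsLocalMax, IsMaxFilter] using this
  have hd : DifferentiableAt ℝ (fderiv ℝ v) x :=
    (hv.fderiv_right (m := 1) (by norm_num)).differentiableAt (by norm_num)
  have hvt : ∀ᶠ t : ℝ in 𝓝 0, DifferentiableAt ℝ v (x + t • e) := by
    refine hline0.eventually ((hv.eventually (by simp)).mono fun y hy => ?_)
    exact hy.differentiableAt (by norm_num)
  have hpos : ∀ᶠ t : ℝ in 𝓝 0, 0 < 1 + k * ((R ^ 2 - ‖x + t • e‖ ^ 2) / (2 * R)) := by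
    have hc : Continuous fun t : ℝ => 1 + k * ((R ^ 2 - ‖x + t • e‖ ^ 2) / (2 * R)) := by
      fun_prop
    exact hc.continuousAt.eventually (lt_mem_nhds (by simpa using hx))
  have hg : ∀ᶠ t : ℝ in 𝓝 0, HasDerivAt ((fun y => v y -
      μ * Real.log (1 + k * ((R ^ 2 - ‖y‖ ^ 2) / (2 * R)))) ∘ fun t : ℝ => x + t • e)
      (fderiv ℝ v (x + t • e) e - -(μ * k * ((inner ℝ x e + t * ‖e‖ ^ 2) / R)
        / (1 + k * ((R ^ 2 - ‖x + t • e‖ ^ 2) / (2 * R))))) t := by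
    filter_upwards [hvt, hpos] with t h1 h2
    exact (hasDerivAt_comp_add_smul h1).sub (hasDerivAt_log_barrier hR h2)
  have h1 : HasDerivAt (fun t : ℝ => fderiv ℝ v (x + t • e)) (fderiv ℝ (fderiv ℝ v) x e) 0 := by
    simpa using hasDerivAt_comp_add_smul (f := fderiv ℝ v) (x := x) (e := e) (t := 0)
      (by simpa using hd)
  have h2 : HasDerivAt (fun t : ℝ => fderiv ℝ v (x + t • e) e)
      (fderiv ℝ (fderiv ℝ v) x e e) 0 := by
    simpa using h1.clm_apply (hasDerivAt_const (0 : ℝ) e)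
  have hg' := h2.fun_sub (hasDerivAt_deriv_log_barrier (e := e) hR hμ hx ha)
  refine ⟨?_, sub_nonpos.1 (hmax'.second_deriv_nonpos hg hg')⟩
  have h0 := hmax'.hasDerivAt_eq_zero hg.self_of_nhds
  simp only [zero_smul, add_zero, zero_mul] at h0
  rw [ha]
  linear_combination h0

/-- The logarithmic barrier is a strict supersolution: the difference of a solution and the
barrier has no interior local maximum. -/
theorem not_isLocalMax_sub_log_barrier {n : ℕ} (hn : 2 ≤ n) {R K μ k a : ℝ} (hR : 0 < R)
    (hK : 0 < K) (hμ : 0 < μ)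
    (hμK : 16 * μ * ((n + 1) * K + (n - 1) / R * (1 + K)) < 1)
    {x : EuclideanSpace ℝ (Fin n)} (hxR : ‖x‖ ≤ R) (hxR' : R ^ 2 ≤ 4 * ‖x‖ ^ 2)
    (hx : 0 < 1 + k * ((R ^ 2 - ‖x‖ ^ 2) / (2 * R)))
    (ha : a = μ * k / (1 + k * ((R ^ 2 - ‖x‖ ^ 2) / (2 * R)))) (haK : 1 + K ≤ a)
    {u φ : EuclideanSpace ℝ (Fin n) → ℝ} (hu : ContDiffAt ℝ 2 u x) (hφ : ContDiffAt ℝ 2 φ x)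
    (hφ₁ : ‖gradient φ x‖ ≤ K) (hφ₂ : ‖iteratedFDeriv ℝ 2 φ x‖ ≤ K)
    (hQ : -((n - 1) / R) ≤ meanCurvOp n u x) :
    ¬ IsLocalMax (fun y => u y - φ y -
      μ * Real.log (1 + k * ((R ^ 2 - ‖y‖ ^ 2) / (2 * R)))) x := by
  intro hmax
  have hcond := hmax.log_barrier_conditions (v := fun y => u y - φ y) hR.ne' hμ.ne'
    (hu.sub hφ) hx ha
  have hdu : DifferentiableAt ℝ u x := hu.differentiableAt (by norm_num)
  have hdφ : DifferentiableAt ℝ φ x := hφ.differentiableAt (by norm_num)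
  have hd1 : fderiv ℝ (fun y => u y - φ y) x = fderiv ℝ u x - fderiv ℝ φ x :=
    fderiv_fun_sub hdu hdφ
  have hd2 : fderiv ℝ (fderiv ℝ (fun y => u y - φ y)) x
      = fderiv ℝ (fderiv ℝ u) x - fderiv ℝ (fderiv ℝ φ) x := by
    have : fderiv ℝ (fun y => u y - φ y) =ᶠ[𝓝 x] fun y => fderiv ℝ u y - fderiv ℝ φ y := by
      filter_upwards [hu.eventually (by simp), hφ.eventually (by simp)] with y h1 h2
      exact fderiv_fun_sub (h1.differentiableAt (by norm_num)) (h2.differentiableAt (by norm_num))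
    rw [this.fderiv_eq]
    exact fderiv_fun_sub ((hu.fderiv_right (m := 1) (by norm_num)).differentiableAt (by norm_num))
      ((hφ.fderiv_right (m := 1) (by norm_num)).differentiableAt (by norm_num))
  rw [hd1, hd2] at hcond
  set Du := fderiv ℝ (fderiv ℝ u) x with hDu
  set Dφ := fderiv ℝ (fderiv ℝ φ) x with hDφ
  have ha0 : 0 < a := by linarith
  set p := gradient u x with hp
  have hpeq : p = gradient φ x - (a / R) • x := by
    refine ext_inner_right ℝ fun e => ?_
    have h := (hcond e).1
    rw [sub_apply] at h
    rw [hp, inner_gradient_left, inner_sub_left, inner_gradient_left, real_inner_smul_left]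
    linear_combination h
  have hpn : ‖p‖ ≤ K + a := by
    calc ‖p‖ ≤ ‖gradient φ x‖ + ‖(a / R) • x‖ := by rw [hpeq]; exact norm_sub_le _ _
      _ ≤ K + a := by
        refine add_le_add hφ₁ ?_
        rw [norm_smul, Real.norm_of_nonneg (by positivity), div_mul_eq_mul_div,
          div_le_iff₀ hR]
        gcongr
  have hφee : ∀ e, |Dφ e e| ≤ K * ‖e‖ ^ 2 := by
    intro e
    have h := (iteratedFDeriv ℝ 2 φ x).le_opNorm ![e, e]
    rw [iteratedFDeriv_two_apply] at h
    simp only [Fin.prod_univ_two, Matrix.cons_val_zero, Matrix.cons_val_one,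
      Real.norm_eq_abs] at h
    calc |Dφ e e| ≤ ‖iteratedFDeriv ℝ 2 φ x‖ * (‖e‖ * ‖e‖) := h
      _ ≤ K * ‖e‖ ^ 2 := by rw [sq]; gcongr
  have hxi : ∑ i, inner ℝ x (EuclideanSpace.single i 1) ^ 2 = ‖x‖ ^ 2 := by
    rw [EuclideanSpace.real_norm_sq_eq]
    simp [EuclideanSpace.inner_single_right]
  have hmain := mul_sum_sub_nonpos_of_diag_nonpos
    (Du.toLinearMap₁₂ - Dφ.toLinearMap₁₂ + (a / R) • innerₗ _
      + (a ^ 2 / μ / R ^ 2) • (innerₗ _ x).smulRight (innerₗ _ x))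
    (fun e => by
      have h := (hcond e).2
      simp only [sub_apply] at h
      simp only [LinearMap.add_apply, LinearMap.sub_apply, LinearMap.smul_apply,
        ContinuousLinearMap.toLinearMap₁₂_apply_apply_apply, LinearMap.smulRight_apply,
        innerₗ_apply_apply, smul_eq_mul, real_inner_self_eq_norm_sq]
      have : a / R * ‖e‖ ^ 2 + a ^ 2 / μ / R ^ 2 * (inner ℝ x e * inner ℝ x e)
        = a * (‖e‖ ^ 2 / R) + a ^ 2 / μ * (inner ℝ x e ^ 2 / R ^ 2) := by ring
      linarith) p
  simp only [LinearMap.add_apply, LinearMap.sub_apply, LinearMap.smul_apply,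
    ContinuousLinearMap.toLinearMap₁₂_apply_apply_apply, LinearMap.smulRight_apply,
    innerₗ_apply_apply, smul_eq_mul, real_inner_self_eq_norm_sq, Finset.sum_add_distrib,
    Finset.sum_sub_distrib, ← Finset.mul_sum, ← sq, hxi, PiLp.norm_single,
    norm_one, one_pow, Finset.sum_const, Finset.card_univ, Fintype.card_fin, nsmul_eq_mul,
    mul_one] at hmain
  have hQ' := meanCurvOp_eq hu
  rw [← hp, ← hDu] at hQ'
  have hpos : 0 < 1 + ‖p‖ ^ 2 := by positivity
  set W := √(1 + ‖p‖ ^ 2) with hW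
  have hWpos : 0 < W := Real.sqrt_pos.2 hpos
  have hW2 : W ^ 2 = 1 + ‖p‖ ^ 2 := Real.sq_sqrt hpos.le
  have hWa : W ≤ 1 + K + a := by
    refine Real.sqrt_le_iff.2 ⟨by positivity, ?_⟩
    nlinarith [norm_nonneg p]
  have hlow : -((n - 1) / R) * W ^ 3 ≤ W ^ 3 * meanCurvOp n u x := by
    rw [mul_comm]
    gcongr
  have hn1 : (1 : ℝ) ≤ n - 1 := by
    have : (2 : ℝ) ≤ n := by exact_mod_cast hn
    linarith
  have hφtr : -(n * K) ≤ -∑ i, Dφ (EuclideanSpace.single i 1) (EuclideanSpace.single i 1) := by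
    refine neg_le_neg ?_
    calc ∑ i, Dφ (EuclideanSpace.single i 1) (EuclideanSpace.single i 1)
        ≤ ∑ _i : Fin n, K := by
          refine Finset.sum_le_sum fun i _ => ?_
          simpa using (le_abs_self _).trans (hφee (EuclideanSpace.single i 1))
      _ = n * K := by simp
  have hφp : -(K * ‖p‖ ^ 2) ≤ Dφ p p := (abs_le.1 (hφee p)).1
  have hcs : inner ℝ x p ^ 2 ≤ ‖x‖ ^ 2 * ‖p‖ ^ 2 := by
    rw [← mul_pow, ← sq_abs]
    gcongr
    exact abs_real_inner_le_norm x p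
  rw [← hW2] at hmain hQ'
  have hp2 : ‖p‖ ^ 2 = W ^ 2 - 1 := by linarith
  rw [hp2] at hcs hφp hmain
  have hφtr' := mul_le_mul_of_nonneg_left hφtr (sq_nonneg W)
  set c := a ^ 2 / μ / R ^ 2 with hc
  have hc0 : 0 ≤ c := by positivity
  have hcs' := mul_le_mul_of_nonneg_left hcs hc0
  have hcx : a ^ 2 / (4 * μ) ≤ c * ‖x‖ ^ 2 := by
    calc a ^ 2 / (4 * μ) = c * (R ^ 2 / 4) := by rw [hc]; field_simp
      _ ≤ c * ‖x‖ ^ 2 := by gcongr; linarith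
  have hRa : 0 ≤ a / R := by positivity
  have hWbound : (n - 1) / R * W ^ 2 * (W - a) ≤ (n - 1) / R * W ^ 2 * (1 + K) := by
    have : 0 ≤ ((n : ℝ) - 1) / R := div_nonneg (by linarith) hR.le
    gcongr
    linarith
  have hsplit : (n - 1) / R * W ^ 2 * (W - a)
      = (n - 1) / R * W ^ 3 - a / R * (n - 1) * W ^ 2 := by ring
  have hest : a ^ 2 / (4 * μ) ≤ W ^ 2 * ((n + 1) * K + (n - 1) / R * (1 + K)) := by
    linarith
  have hA : 0 ≤ (n + 1) * K + (n - 1) / R * (1 + K) := by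
    have : 0 ≤ ((n : ℝ) - 1) / R := div_nonneg (by linarith) hR.le
    positivity
  have hest' : a ^ 2 / (4 * μ) ≤ (2 * a) ^ 2 * ((n + 1) * K + (n - 1) / R * (1 + K)) := by
    refine hest.trans ?_
    gcongr
    linarith
  rw [div_le_iff₀ (by positivity)] at hest'
  have : a ^ 2 * 1 ≤ a ^ 2 * (16 * μ * ((n + 1) * K + (n - 1) / R * (1 + K))) := by
    linarith
  exact absurd (le_of_mul_le_mul_left this (by positivity)) (not_le.2 hμK)

/-- Comparison with the logarithmic barrier near the boundary sphere. -/
theorem sub_le_mul_of_meanCurvOp_ge {n : ℕ} (hn : 2 ≤ n) {R K B μ k δ : ℝ} (hR : 0 < R)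
    (hK : 0 < K) (hμ : 0 < μ) (hk : 0 < k)
    (hμK : 16 * μ * ((n + 1) * K + (n - 1) / R * (1 + K)) < 1)
    (hδR : 8 * δ ≤ 3 * R) (hδK : (1 + K) * (1 + k * δ) ≤ μ * k)
    (hδB : B ≤ μ * Real.log (1 + k * δ))
    {u φ : EuclideanSpace ℝ (Fin n) → ℝ}
    (huc : ContinuousOn u (Metric.closedBall 0 R)) (hu : ContDiffOn ℝ 2 u (Metric.ball 0 R))
    (hφ : ContDiff ℝ 2 φ)
    (hφ₁ : ∀ x ∈ Metric.closedBall 0 R, ‖gradient φ x‖ ≤ K)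
    (hφ₂ : ∀ x ∈ Metric.closedBall 0 R, ‖iteratedFDeriv ℝ 2 φ x‖ ≤ K)
    (hQ : ∀ x ∈ Metric.ball 0 R, -((n - 1) / R) ≤ meanCurvOp n u x)
    (hbd : ∀ x, ‖x‖ = R → u x = φ x)
    (hB : ∀ x ∈ Metric.closedBall 0 R, u x - φ x ≤ B)
    {y : EuclideanSpace ℝ (Fin n)} (hyR : ‖y‖ ≤ R) (hyδ : (R ^ 2 - ‖y‖ ^ 2) / (2 * R) ≤ δ) :
    u y - φ y ≤ μ * k * (R - ‖y‖) := by
  set d : EuclideanSpace ℝ (Fin n) → ℝ := fun z => (R ^ 2 - ‖z‖ ^ 2) / (2 * R) with hd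
  have hdc : Continuous d := by fun_prop
  have hd0 : ∀ z, ‖z‖ ≤ R → 0 ≤ d z := by
    intro z hz
    refine div_nonneg ?_ (by positivity)
    have : ‖z‖ ^ 2 ≤ R ^ 2 := by gcongr
    linarith
  have hkd : ∀ z, ‖z‖ ≤ R → 0 < 1 + k * d z := by
    intro z hz
    have := hd0 z hz
    positivity
  set v : EuclideanSpace ℝ (Fin n) → ℝ := fun z => u z - φ z - μ * Real.log (1 + k * d z) with hv
  set S : Set (EuclideanSpace ℝ (Fin n)) := Metric.closedBall 0 R ∩ {z | d z ≤ δ} with hS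
  have hScompact : IsCompact S :=
    (isCompact_closedBall _ _).inter_right (isClosed_le hdc continuous_const)
  have hvc : ContinuousOn v S := by
    have hlog : ContinuousOn (fun z => Real.log (1 + k * d z)) S := by
      refine ContinuousOn.log (by fun_prop) fun z hz => (hkd z ?_).ne'
      simpa using hz.1
    exact ((huc.mono Set.inter_subset_left).sub hφ.continuous.continuousOn).sub
      (continuousOn_const.mul hlog)
  have hyS : y ∈ S := ⟨by simpa using hyR, hyδ⟩
  obtain ⟨z, hzS, hzmax⟩ := hScompact.exists_isMaxOn ⟨y, hyS⟩ hvc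
  have hzR : ‖z‖ ≤ R := by simpa using hzS.1
  have hvz : v z ≤ 0 := by
    rcases hzR.eq_or_lt with hz | hz
    · simp [hv, hd, hz, hbd z hz]
    rcases (show d z ≤ δ from hzS.2).eq_or_lt with hzδ | hzδ
    · have := hB z hzS.1
      simp only [hv, hzδ]
      linarith
    exfalso
    have hzball : Metric.ball (0 : EuclideanSpace ℝ (Fin n)) R ∈ 𝓝 z :=
      Metric.isOpen_ball.mem_nhds (by simpa using hz)
    have hloc : IsLocalMax v z := by
      refine hzmax.isLocalMax (Filter.inter_mem ?_ ?_)
      · exact Filter.mem_of_superset hzball Metric.ball_subset_closedBall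
      · exact (hdc.continuousAt.eventually (gt_mem_nhds hzδ)).mono fun w hw => le_of_lt hw
    refine not_isLocalMax_sub_log_barrier hn hR hK hμ hμK hzR ?_ (hkd z hzR) rfl ?_
      (hu.contDiffAt hzball) hφ.contDiffAt (hφ₁ z hzS.1) (hφ₂ z hzS.1)
      (hQ z (by simpa using hz)) hloc
    · have := hzδ.le
      rw [hd, div_le_iff₀ (by positivity)] at this
      nlinarith
    · rw [le_div_iff₀ (hkd z hzR)]
      refine le_trans ?_ hδK
      gcongr
  have hvy : v y ≤ 0 := (hzmax hyS).trans hvz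
  have hlog : Real.log (1 + k * d y) ≤ k * d y := by
    have := Real.log_le_sub_one_of_pos (hkd y hyR)
    linarith
  have hdy : d y ≤ R - ‖y‖ := by
    rw [hd, div_le_iff₀ (by positivity)]
    nlinarith [sq_nonneg (R - ‖y‖)]
  calc u y - φ y ≤ μ * Real.log (1 + k * d y) := by
        simp only [hv] at hvy
        linarith
    _ ≤ μ * (k * (R - ‖y‖)) := by
        gcongr
        exact hlog.trans (by gcongr)
    _ = μ * k * (R - ‖y‖) := by ring

/-- A Lipschitz bound at a boundary point of a ball bounds the derivative within the
ball. -/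
theorem norm_le_of_hasFDerivWithinAt_closedBall {E : Type*} [NormedAddCommGroup E]
    [InnerProductSpace ℝ E] {R C : ℝ} (hR : 0 < R) (hC : 0 ≤ C) {u : E → ℝ} {L : E →L[ℝ] ℝ}
    {x : E} (hx : ‖x‖ = R) (hL : HasFDerivWithinAt u L (Metric.closedBall 0 R) x)
    (hu : ∀ᶠ y in 𝓝[Metric.closedBall 0 R] x, |u y - u x| ≤ C * ‖y - x‖) : ‖L‖ ≤ C := by
  have hinward : ∀ v : E, inner ℝ x v < 0 → ‖L v‖ ≤ C * ‖v‖ := by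
    intro v hv
    have hline : Tendsto (fun t : ℝ => t • v) (𝓝[>] 0) (𝓝 0) := by
      have : Continuous fun t : ℝ => t • v := by fun_prop
      simpa using (this.tendsto 0).mono_left nhdsWithin_le_nhds
    have hmem : ∀ᶠ t : ℝ in 𝓝[>] 0, x + t • v ∈ Metric.closedBall 0 R := by
      have hsmall : ∀ᶠ t : ℝ in 𝓝[>] 0, 2 * inner ℝ x v + t * ‖v‖ ^ 2 < 0 := by
        have hc : Continuous fun t : ℝ => 2 * inner ℝ x v + t * ‖v‖ ^ 2 := by fun_prop
        refine nhdsWithin_le_nhds (hc.continuousAt.eventually (gt_mem_nhds ?_))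
        simpa using mul_neg_of_pos_of_neg two_pos hv
      filter_upwards [hsmall, self_mem_nhdsWithin] with t ht ht0
      rw [mem_closedBall_zero_iff]
      refine le_of_sq_le_sq ?_ hR.le
      rw [norm_add_sq_real, inner_smul_right, norm_smul, mul_pow, Real.norm_eq_abs, sq_abs, hx]
      nlinarith [show (0 : ℝ) < t from ht0]
    have hlim := hL.lim hline hmem (c := fun t : ℝ => t⁻¹) (v := v) (by
      refine tendsto_const_nhds.congr' ?_
      filter_upwards [self_mem_nhdsWithin] with t ht
      rw [smul_smul, inv_mul_cancel₀ (ne_of_gt ht), one_smul])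
    refine le_of_tendsto hlim.norm ?_
    have hx' : Tendsto (fun t : ℝ => x + t • v) (𝓝[>] 0) (𝓝[Metric.closedBall 0 R] x) :=
      tendsto_nhdsWithin_iff.2 ⟨by simpa using hline.const_add x, hmem⟩
    filter_upwards [hx'.eventually hu, self_mem_nhdsWithin] with t ht ht0
    have ht0' : (0 : ℝ) < t := ht0
    rw [add_sub_cancel_left, norm_smul, Real.norm_of_nonneg ht0'.le] at ht
    rw [norm_smul, Real.norm_eq_abs, Real.norm_eq_abs, abs_of_pos (inv_pos.2 ht0'),
      inv_mul_le_iff₀ ht0']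
    linarith
  have hhalf : ∀ v : E, inner ℝ x v ≤ 0 → ‖L v‖ ≤ C * ‖v‖ := by
    intro v hv
    have hc : Continuous fun ε : ℝ => v - ε • x := by fun_prop
    have htend : Tendsto (fun ε : ℝ => v - ε • x) (𝓝[>] 0) (𝓝 v) := by
      simpa using (hc.tendsto 0).mono_left nhdsWithin_le_nhds
    refine le_of_tendsto_of_tendsto ((L.continuous.tendsto v).comp htend).norm
      (htend.norm.const_mul C) ?_
    filter_upwards [self_mem_nhdsWithin] with ε hε
    refine hinward _ ?_
    have hε' : (0 : ℝ) < ε := hε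
    rw [inner_sub_right, inner_smul_right, real_inner_self_eq_norm_sq, hx]
    have : 0 < ε * R ^ 2 := by positivity
    linarith
  refine L.opNorm_le_bound hC fun v => ?_
  rcases le_total (inner ℝ x v) 0 with hv | hv
  · exact hhalf v hv
  · simpa using hhalf (-v) (by simpa using hv)

/-- A priori boundary gradient estimate for prescribed mean curvature graphs
over a round ball `Ω = B(0, R)` in `ℝⁿ`: for all `M, K > 0` there is
`C = C(n, R, M, K) > 0` such that every solution `u` of `Q[u] = nH` on `Ω`
with `sup |H| ≤ (n−1)/(nR)`, boundary values `φ` with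
`|φ| + ‖∇φ‖ + ‖D²φ‖ ≤ K`, and height bound `|u| ≤ M` satisfies
`sup_{∂Ω} ‖∇u‖ ≤ C`. -/
theorem prescribed_mean_curvature_boundary_gradient_estimate
    (n : ℕ) (hn : 2 ≤ n) (R : ℝ) (hR : 0 < R)
    (Ω : Set (EuclideanSpace ℝ (Fin n)))
    (hΩ : Ω = Metric.ball (0 : EuclideanSpace ℝ (Fin n)) R)
    (M K : ℝ) (hM : 0 < M) (hK : 0 < K) :
    ∃ C : ℝ, 0 < C ∧
      ∀ (H φ u : EuclideanSpace ℝ (Fin n) → ℝ),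
        ContinuousOn H (closure Ω) →
        (∀ x ∈ closure Ω, |H x| ≤ ((n : ℝ) - 1) / (n * R)) →
        ContDiff ℝ 2 φ →
        (∀ x ∈ closure Ω,
          |φ x| + ‖gradient φ x‖ + ‖iteratedFDeriv ℝ 2 φ x‖ ≤ K) →
        ContDiffOn ℝ 1 u (closure Ω) →
        ContDiffOn ℝ 2 u Ω →
        (∀ x ∈ Ω, meanCurvOp n u x = n * H x) →
        (∀ x ∈ closure Ω \ Ω, u x = φ x) →
        (∀ x ∈ closure Ω, |u x| ≤ M) →
        ∀ x ∈ closure Ω \ Ω, ‖fderivWithin ℝ u (closure Ω) x‖ ≤ C := by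
  have hn1 : (1 : ℝ) ≤ n - 1 := by
    have : (2 : ℝ) ≤ n := by exact_mod_cast hn
    linarith
  have hcl : closure Ω = Metric.closedBall 0 R := by rw [hΩ, closure_ball _ hR.ne']
  have hnR : 0 < ((n : ℝ) - 1) / R := div_pos (by linarith) hR
  set A : ℝ := (n + 1) * K + (n - 1) / R * (1 + K) with hA
  have hApos : 0 < A := by positivity
  obtain ⟨μ, hμ, hμA⟩ : ∃ μ : ℝ, 0 < μ ∧ 16 * μ * A < 1 := by
    refine ⟨1 / (32 * A), by positivity, ?_⟩
    have : 16 * (1 / (32 * A)) * A = 1 / 2 := by field_simp; norm_num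
    rw [this]
    norm_num
  obtain ⟨δ, hδ, hδR, hδK⟩ : ∃ δ : ℝ, 0 < δ ∧ 8 * δ ≤ 3 * R ∧ 2 * (1 + K) * δ ≤ μ := by
    refine ⟨min (3 * R / 8) (μ / (2 * (1 + K))), by positivity, ?_, ?_⟩
    · linarith [min_le_left (3 * R / 8) (μ / (2 * (1 + K)))]
    · have h := min_le_right (3 * R / 8) (μ / (2 * (1 + K)))
      rw [le_div_iff₀ (by positivity)] at h
      linarith
  obtain ⟨k, hk, hkδ, hkB⟩ :
      ∃ k : ℝ, 0 < k ∧ 1 ≤ k * δ ∧ M + K ≤ μ * Real.log (1 + k * δ) := by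
    refine ⟨Real.exp ((M + K) / μ) / δ, by positivity, ?_, ?_⟩
    · rw [div_mul_cancel₀ _ hδ.ne']
      exact Real.one_le_exp (by positivity)
    · rw [div_mul_cancel₀ _ hδ.ne']
      have h : (M + K) / μ ≤ Real.log (1 + Real.exp ((M + K) / μ)) := by
        rw [Real.le_log_iff_exp_le (by positivity)]
        linarith
      rwa [div_le_iff₀' hμ] at h
  have hslope : (1 + K) * (1 + k * δ) ≤ μ * k := by
    calc (1 + K) * (1 + k * δ) ≤ (1 + K) * (k * δ + k * δ) := by gcongr
      _ = 2 * (1 + K) * δ * k := by ring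
      _ ≤ μ * k := by gcongr
  refine ⟨K + μ * k, by positivity, ?_⟩
  intro H φ u _ hH hφ hφK hu1 hu2 hQ hbd huM x hx
  rw [hcl] at hH hφK hu1 hbd huM hx ⊢
  subst hΩ
  have hxR : ‖x‖ = R := by
    refine le_antisymm (by simpa using hx.1) ?_
    simpa using hx.2
  have hφ₀ : ∀ y ∈ Metric.closedBall 0 R, |φ y| ≤ K := fun y hy => by
    linarith [hφK y hy, norm_nonneg (gradient φ y), norm_nonneg (iteratedFDeriv ℝ 2 φ y)]
  have hφ₁ : ∀ y ∈ Metric.closedBall 0 R, ‖gradient φ y‖ ≤ K := fun y hy => by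
    linarith [hφK y hy, abs_nonneg (φ y), norm_nonneg (iteratedFDeriv ℝ 2 φ y)]
  have hφ₂ : ∀ y ∈ Metric.closedBall 0 R, ‖iteratedFDeriv ℝ 2 φ y‖ ≤ K := fun y hy => by
    linarith [hφK y hy, abs_nonneg (φ y), norm_nonneg (gradient φ y)]
  have hbd' : ∀ y, ‖y‖ = R → u y = φ y := fun y hy => hbd y (by simp [hy])
  have hQabs : ∀ y ∈ Metric.ball 0 R, |meanCurvOp n u y| ≤ (n - 1) / R := by
    intro y hy
    rw [hQ y hy, abs_mul, Nat.abs_cast]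
    have hn0 : (0 : ℝ) < n := by linarith
    calc (n : ℝ) * |H y| ≤ n * ((n - 1) / (n * R)) := by
          gcongr
          exact hH y (Metric.ball_subset_closedBall hy)
      _ = (n - 1) / R := by field_simp
  have hupper : ∀ y : EuclideanSpace ℝ (Fin n), ‖y‖ ≤ R → (R ^ 2 - ‖y‖ ^ 2) / (2 * R) ≤ δ →
      u y - φ y ≤ μ * k * (R - ‖y‖) := fun y hy hyδ =>
    sub_le_mul_of_meanCurvOp_ge hn hR hK hμ hk hμA hδR hslope hkB hu1.continuousOn hu2 hφ hφ₁ hφ₂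
      (fun z hz => (abs_le.1 (hQabs z hz)).1) hbd'
      (fun z hz => by linarith [(abs_le.1 (huM z hz)).2, (abs_le.1 (hφ₀ z hz)).1]) hy hyδ
  have hlower : ∀ y : EuclideanSpace ℝ (Fin n), ‖y‖ ≤ R → (R ^ 2 - ‖y‖ ^ 2) / (2 * R) ≤ δ →
      -u y - -φ y ≤ μ * k * (R - ‖y‖) := fun y hy hyδ =>
    sub_le_mul_of_meanCurvOp_ge (u := fun z => -u z) (φ := fun z => -φ z) hn hR hK hμ hk hμA hδR
      hslope hkB hu1.continuousOn.neg hu2.neg hφ.neg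
      (fun z hz => by simpa [gradient, fderiv_fun_neg] using hφ₁ z hz)
      (fun z hz => by
        have h : iteratedFDeriv ℝ 2 (fun z => -φ z) z = -iteratedFDeriv ℝ 2 φ z :=
          iteratedFDeriv_neg_apply
        rw [h, norm_neg]
        exact hφ₂ z hz)
      (fun z hz => by
        rw [meanCurvOp_neg]
        linarith [(abs_le.1 (hQabs z hz)).2])
      (fun z hz => by rw [hbd' z hz])
      (fun z hz => by linarith [(abs_le.1 (huM z hz)).1, (abs_le.1 (hφ₀ z hz)).2]) hy hyδ
  refine norm_le_of_hasFDerivWithinAt_closedBall hR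
    (by positivity) hxR (hu1.differentiableOn (by norm_num) x hx.1).hasFDerivWithinAt ?_
  have hnear : ∀ᶠ y in 𝓝[Metric.closedBall 0 R] x, (R ^ 2 - ‖y‖ ^ 2) / (2 * R) < δ := by
    have hc : Continuous fun y : EuclideanSpace ℝ (Fin n) => (R ^ 2 - ‖y‖ ^ 2) / (2 * R) := by
      fun_prop
    exact nhdsWithin_le_nhds (hc.continuousAt.eventually (gt_mem_nhds (by simpa [hxR] using hδ)))
  filter_upwards [hnear, self_mem_nhdsWithin] with y hyδ hy
  have hyR : ‖y‖ ≤ R := by simpa using hy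
  have hφxy : |φ y - φ x| ≤ K * ‖y - x‖ :=
    (convex_closedBall (0 : EuclideanSpace ℝ (Fin n)) R).norm_image_sub_le_of_norm_fderiv_le
      (fun z _ => (hφ.differentiable (by norm_num)) z)
      (fun z hz => by simpa [gradient] using hφ₁ z hz) hx.1 hy
  have huφ : |u y - φ y| ≤ μ * k * (R - ‖y‖) :=
    abs_le.2 ⟨by linarith [hlower y hyR hyδ.le], hupper y hyR hyδ.le⟩
  have hdist : R - ‖y‖ ≤ ‖y - x‖ := by
    rw [← hxR, norm_sub_rev]
    exact norm_sub_norm_le x y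
  calc |u y - u x| = |(u y - φ y) + (φ y - φ x)| := by
        rw [hbd' x hxR]
        ring_nf
    _ ≤ |u y - φ y| + |φ y - φ x| := abs_add_le _ _
    _ ≤ μ * k * ‖y - x‖ + K * ‖y - x‖ := by
        refine add_le_add (huφ.trans ?_) hφxy
        gcongr
    _ = (K + μ * k) * ‖y - x‖ := by ring
end
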